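/- Let H be a complex m×n matrix, let Q be an m×m Hermitian positive definite complex matrix, and let S and S₀ be n×n Hermitian positive semidefinite complex matrices. Then log det(H·S·Hᴴ + Q) ≤ log det(H·S₀·Hᴴ + Q) + Re( Tr( (H·S₀·Hᴴ + Q)⁻¹ · H·(S − S₀)·Hᴴ ) ), where the determinants are of Hermitian positive definite matrices and hence positive real, and log denotes the real logarithm. -/

import Mathlib

open Matrix ComplexOrder

/-- For a positive definite matrix, `log det M ≤ tr M - dim`. -/
lemma Matrix.PosDef.log_re_det_le_re_trace_sub_card {ι : Type*} [Fintype ι] [DecidableEq ι]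
    {M : Matrix ι ι ℂ} (hM : M.PosDef) :
    Real.log M.det.re ≤ M.trace.re - Fintype.card ι := by
  have hdet : M.det.re = ∏ i, hM.isHermitian.eigenvalues i := by
    rw [hM.isHermitian.det_eq_prod_eigenvalues]
    exact_mod_cast Complex.ofReal_re _
  have htr : M.trace.re = ∑ i, hM.isHermitian.eigenvalues i := by
    rw [hM.isHermitian.trace_eq_sum_eigenvalues]
    exact_mod_cast Complex.ofReal_re _
  rw [hdet, htr, Real.log_prod fun i _ => (hM.eigenvalues_pos i).ne']
  calc ∑ i, Real.log (hM.isHermitian.eigenvalues i)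
      ≤ ∑ i, (hM.isHermitian.eigenvalues i - 1) :=
        Finset.sum_le_sum fun i _ => Real.log_le_sub_one_of_pos (hM.eigenvalues_pos i)
    _ = _ := by simp

open scoped MatrixOrder Matrix.Norms.L2Operator in
/-- The tangent-plane upper bound for the concave function `log det` on positive definite
matrices. -/
lemma Matrix.PosDef.log_re_det_le_add_re_trace {ι : Type*} [Fintype ι] [DecidableEq ι]
    {A B : Matrix ι ι ℂ} (hA : A.PosDef) (hB : B.PosDef) :
    Real.log A.det.re ≤ Real.log B.det.re + (B⁻¹ * (A - B)).trace.re := by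
  have hBu : IsUnit B.det := (Matrix.isUnit_iff_isUnit_det B).mp hB.isUnit
  obtain ⟨C, hC⟩ : ∃ C : Matrix ι ι ℂ, B⁻¹ = Cᴴ * C :=
    CStarAlgebra.nonneg_iff_eq_star_mul_self.mp hB.inv.posSemidef.nonneg
  have hCu : IsUnit C := by
    have h : IsUnit (Cᴴ * C).det := hC ▸ (Matrix.isUnit_iff_isUnit_det _).mp hB.inv.isUnit
    rw [Matrix.det_mul] at h
    exact (Matrix.isUnit_iff_isUnit_det C).mpr (isUnit_of_mul_isUnit_right h)
  have hM : (C * A * Cᴴ).PosDef :=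
    hA.mul_mul_conjTranspose_same (Matrix.vecMul_injective_of_isUnit hCu)
  have htr : (B⁻¹ * (A - B)).trace = (C * A * Cᴴ).trace - Fintype.card ι := by
    rw [Matrix.mul_sub, Matrix.nonsing_inv_mul B hBu, Matrix.trace_sub, Matrix.trace_one, hC,
      Matrix.trace_mul_comm (C * A), Matrix.mul_assoc]
  have hdet : A.det = (C * A * Cᴴ).det * B.det := by
    have h : Cᴴ.det * C.det * B.det = 1 := by
      rw [← Matrix.det_mul, ← hC, ← Matrix.det_mul, Matrix.nonsing_inv_mul B hBu, Matrix.det_one]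
    rw [Matrix.det_mul, Matrix.det_mul]
    linear_combination -A.det * h
  obtain ⟨hMre, hMim⟩ := Complex.pos_iff.mp hM.det_pos
  have hBre := (Complex.pos_iff.mp hB.det_pos).1
  have hre : A.det.re = (C * A * Cᴴ).det.re * B.det.re := by
    rw [hdet, Complex.mul_re, ← hMim, zero_mul, sub_zero]
  have key := hM.log_re_det_le_re_trace_sub_card
  rw [hre, Real.log_mul hMre.ne' hBre.ne', htr, Complex.sub_re, Complex.natCast_re]
  linarith

/-- First-order (SCA) upper bound for the concave function `S ↦ log det(H·S·Hᴴ + Q)`: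
for `H` a complex `m × n` matrix, `Q` Hermitian positive definite, and `S`, `S₀`
Hermitian positive semidefinite,
`log det(H·S·Hᴴ + Q) ≤ log det(H·S₀·Hᴴ + Q) + Re(Tr((H·S₀·Hᴴ + Q)⁻¹·H·(S − S₀)·Hᴴ))`,
where the logarithms are real logarithms of the (positive real) determinants. -/
theorem logdet_first_order_bound (m n : ℕ)
    (H : Matrix (Fin m) (Fin n) ℂ)
    (Q : Matrix (Fin m) (Fin m) ℂ) (hQ : Q.PosDef)
    (S S₀ : Matrix (Fin n) (Fin n) ℂ)
    (hS : S.PosSemidef) (hS₀ : S₀.PosSemidef) :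
    Real.log (H * S * Hᴴ + Q).det.re ≤
      Real.log (H * S₀ * Hᴴ + Q).det.re +
        (((H * S₀ * Hᴴ + Q)⁻¹ * (H * (S - S₀) * Hᴴ)).trace).re := by
  have hpos : ∀ {T : Matrix (Fin n) (Fin n) ℂ}, T.PosSemidef → (H * T * Hᴴ + Q).PosDef :=
    fun hT => Matrix.PosDef.posSemidef_add (hT.mul_mul_conjTranspose_same H) hQ
  have hsub : H * (S - S₀) * Hᴴ = (H * S * Hᴴ + Q) - (H * S₀ * Hᴴ + Q) := by
    rw [Matrix.mul_sub, Matrix.sub_mul, add_sub_add_right_eq_sub]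
  rw [hsub]
  exact (hpos hS).log_re_det_le_add_re_trace (hpos hS₀)
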